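/- There exist c > 0 and constants ε > 0, Δ > 0 such that for every T ≥ 0 there exists a solution X of the time-delay system (S_c) with initial segment satisfying ‖X0‖ ≤ Δ and with |X(t)| > ε for all t ∈ [0, T]. Consequently, the origin of (S_c) is not weakly uniformly globally attractive: the time needed for solutions starting in the ball of radius Δ to first touch the ball of radius ε cannot be bounded uniformly. -/

import Mathlib

open Set Matrix

/-- The matrix `A0`. -/
noncomputable def A0 : Matrix (Fin 2) (Fin 2) ℝ := !![-0.1, 0.5; -2, 0]

/-- The matrix `A1`. -/
noncomputable def A1 : Matrix (Fin 2) (Fin 2) ℝ := !![0, 2; -0.5, -0.1]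

/-- The saturation function `φ`. -/
noncomputable def phi (s : ℝ) : ℝ := if s < 0 then 0 else if s ≤ 1 then s else 1

/-- `ℝ²` with the Euclidean norm. -/
abbrev E2 : Type := EuclideanSpace ℝ (Fin 2)

/-- Action of a `2 × 2` matrix on `ℝ²`. -/
noncomputable def act (A : Matrix (Fin 2) (Fin 2) ℝ) (x : E2) : E2 :=
  Matrix.toEuclideanLin A x

/-- The nonlinearity `g(x,u) = (1+|x|²)(φ(u) A1 + (1-φ(u)) A0) x`. -/
noncomputable def gfun (x : E2) (u : ℝ) : E2 :=
  (1 + ‖x‖ ^ 2) • act (phi u • A1 + (1 - phi u) • A0) x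

/-- `X = (x, z1, z2) : [-2,∞) → ℝ² × ℝ × ℝ` is a solution of the time-delay system `(S_c)`. -/
def IsSolution (c : ℝ) (x : ℝ → E2) (z1 z2 : ℝ → ℝ) : Prop :=
  ContinuousOn x (Ici (-2 : ℝ)) ∧ ContinuousOn z1 (Ici (-2 : ℝ)) ∧
  ContinuousOn z2 (Ici (-2 : ℝ)) ∧
  ∀ t : ℝ, 0 < t →
    HasDerivAt x ((c * phi (z2 (t - 2))) • gfun (x t) (z1 (t - 1))
      + (c * (1 - phi (z2 (t - 2)))) • act A0 (x t)) t
    ∧ HasDerivAt z1 (-(z1 t)) t ∧ HasDerivAt z2 (-(z2 t)) t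

/-- Euclidean norm `|X(t)|` of the full state `(x(t), z1(t), z2(t)) ∈ ℝ⁴`. -/
noncomputable def Xnorm (x : ℝ → E2) (z1 z2 : ℝ → ℝ) (t : ℝ) : ℝ :=
  Real.sqrt (‖x t‖ ^ 2 + (z1 t) ^ 2 + (z2 t) ^ 2)

/-- Norm `‖X0‖ = sup_{τ ∈ [-2,0]} |X(τ)|` of the initial segment of a solution. -/
noncomputable def initNorm (x : ℝ → E2) (z1 z2 : ℝ → ℝ) : ℝ :=
  sSup (Xnorm x z1 z2 '' Icc (-2 : ℝ) 0)

lemma phi_eq_self {s : ℝ} (h0 : 0 ≤ s) (h1 : s ≤ 1) : phi s = s := by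
  simp [phi, not_lt.mpr h0, h1]

/-- A positive continuous speed bounded below reparametrizes the line: the map
`ψ ↦ ∫₀^ψ h` has a differentiable increasing inverse. -/
lemma exists_clock {h : ℝ → ℝ} (hc : Continuous h) {δ : ℝ} (hδ : 0 < δ) (hh : ∀ s, δ ≤ h s) :
    ∃ Ψ : ℝ → ℝ, Continuous Ψ ∧ StrictMono Ψ ∧ (∀ s, Ψ (∫ r in (0 : ℝ)..s, h r) = s) ∧
      (∀ t, ∫ r in (0 : ℝ)..Ψ t, h r = t) ∧ ∀ t, HasDerivAt Ψ (h (Ψ t))⁻¹ t := by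
  set τ : ℝ → ℝ := fun s => ∫ r in (0 : ℝ)..s, h r with hτ
  have hd : ∀ s, HasDerivAt τ (h s) s := fun s => hc.integral_hasStrictDerivAt 0 s |>.hasDerivAt
  have hpos : ∀ s, 0 < h s := fun s => hδ.trans_le (hh s)
  have hmono : StrictMono τ :=
    strictMono_of_deriv_pos fun s => by rw [(hd s).deriv]; exact hpos s
  have hcont : Continuous τ := continuous_iff_continuousAt.mpr fun s => (hd s).continuousAt
  have hlin : Monotone fun s => τ s - δ * s := by
    have hd' : ∀ s, HasDerivAt (fun s => τ s - δ * s) (h s - δ * 1) s := fun s =>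
      (hd s).sub ((hasDerivAt_id s).const_mul δ)
    refine monotone_of_deriv_nonneg (fun s => (hd' s).differentiableAt) fun s => ?_
    rw [(hd' s).deriv]; linarith [hh s]
  have h0 : τ 0 = 0 := by simp [hτ]
  have hsurj : Function.Surjective τ := by
    refine hcont.surjective ?_ ?_
    · refine Filter.tendsto_atTop_mono' _ ?_ (Filter.tendsto_id.const_mul_atTop hδ)
      filter_upwards [Filter.eventually_ge_atTop 0] with s hs
      have := hlin hs
      simp only [h0, mul_zero, id] at this ⊢
      linarith
    · refine Filter.tendsto_atBot_mono' _ ?_ (Filter.tendsto_id.const_mul_atBot hδ)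
      filter_upwards [Filter.eventually_le_atBot 0] with s hs
      have := hlin hs
      simp only [h0, mul_zero, id] at this ⊢
      linarith
  set e := hmono.orderIsoOfSurjective τ hsurj with he
  have hr : ∀ t, τ (e.symm t) = t := fun t => e.apply_symm_apply t
  refine ⟨e.symm, e.symm.continuous, e.symm.strictMono, fun s => e.symm_apply_apply s, hr,
    fun t => ?_⟩
  exact HasDerivAt.of_local_left_inverse e.symm.continuous.continuousAt (hd _) (hpos _).ne'
    (Filter.Eventually.of_forall hr)

/-- Rate of change of `log |x|` at angle `-ψ` under `ẋ = (u A1 + (1 - u) A0) x`. -/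
noncomputable def radialRate (u ψ : ℝ) : ℝ :=
  -0.1 * (1 - u) * Real.cos ψ ^ 2 - 0.1 * u * Real.sin ψ ^ 2
    - Real.cos ψ * Real.sin ψ * (3 * u - 1.5)

/-- Clockwise angular speed at angle `-ψ` under `ẋ = (u A1 + (1 - u) A0) x`. -/
noncomputable def angularRate (u ψ : ℝ) : ℝ :=
  Real.cos ψ ^ 2 * (2 - 1.5 * u) - Real.cos ψ * Real.sin ψ * (0.2 * u - 0.1)
    + Real.sin ψ ^ 2 * (0.5 + 1.5 * u)

/-- The unit vector at angle `-ψ`. -/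
noncomputable def dir (ψ : ℝ) : E2 := !₂[Real.cos ψ, -Real.sin ψ]

/-- The derivative of `dir`. -/
noncomputable def dirPerp (ψ : ℝ) : E2 := !₂[-Real.sin ψ, -Real.cos ψ]

lemma norm_dir (ψ : ℝ) : ‖dir ψ‖ = 1 := by
  simp [EuclideanSpace.norm_eq, dir]

lemma hasDerivAt_dir (ψ : ℝ) : HasDerivAt dir (dirPerp ψ) ψ := by
  have h : HasDerivAt (fun ψ => ![Real.cos ψ, -Real.sin ψ]) ![-Real.sin ψ, -Real.cos ψ] ψ := by
    rw [hasDerivAt_pi]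
    intro i
    fin_cases i
    · simpa using Real.hasDerivAt_cos ψ
    · exact (Real.hasDerivAt_sin ψ).neg
  exact (PiLp.continuousLinearEquiv 2 ℝ fun _ : Fin 2 => ℝ).symm.hasFDerivAt.comp_hasDerivAt ψ h

lemma act_dir (u r ψ : ℝ) :
    act (u • A1 + (1 - u) • A0) (r • dir ψ) =
      (radialRate u ψ * r) • dir ψ + (angularRate u ψ * r) • dirPerp ψ := by
  have h := Real.sin_sq_add_cos_sq ψ
  ext i
  fin_cases i
  · simp [act, A0, A1, dir, dirPerp, Matrix.toLpLin_apply,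
      radialRate, angularRate]
    linear_combination (0.1 * (1 - u) * Real.cos ψ + (0.5 + 1.5 * u) * Real.sin ψ) * r * h
  · simp [act, A0, A1, dir, dirPerp, Matrix.toLpLin_apply,
      radialRate, angularRate]
    linear_combination ((2 - 1.5 * u) * Real.cos ψ - 0.1 * u * Real.sin ψ) * r * h

lemma angularRate_mem {u : ℝ} (h0 : 0 ≤ u) (h1 : u ≤ 1) (ψ : ℝ) :
    0.4 ≤ angularRate u ψ ∧ angularRate u ψ ≤ 2.1 := by
  have h := Real.sin_sq_add_cos_sq ψ
  have ha : angularRate u ψ = (1 - u) * (2 * Real.cos ψ ^ 2 + 0.1 * (Real.cos ψ * Real.sin ψ)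
      + 0.5 * Real.sin ψ ^ 2) + u * (0.5 * Real.cos ψ ^ 2 - 0.1 * (Real.cos ψ * Real.sin ψ)
      + 2 * Real.sin ψ ^ 2) := by unfold angularRate; ring
  have hp := sq_nonneg (Real.cos ψ + Real.sin ψ)
  have hm := sq_nonneg (Real.cos ψ - Real.sin ψ)
  have hC := sq_nonneg (Real.cos ψ)
  have hS := sq_nonneg (Real.sin ψ)
  rw [ha]
  set P := 2 * Real.cos ψ ^ 2 + 0.1 * (Real.cos ψ * Real.sin ψ) + 0.5 * Real.sin ψ ^ 2 with hP
  set Q := 0.5 * Real.cos ψ ^ 2 - 0.1 * (Real.cos ψ * Real.sin ψ) + 2 * Real.sin ψ ^ 2 with hQ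
  have p1 : 0.4 ≤ P := by nlinarith
  have p2 : P ≤ 2.1 := by nlinarith
  have q1 : 0.4 ≤ Q := by nlinarith
  have q2 : Q ≤ 2.1 := by nlinarith
  constructor <;> nlinarith

lemma radialRate_ge {u : ℝ} (h0 : 0 ≤ u) (h1 : u ≤ 1) (ψ : ℝ) : -0.85 ≤ radialRate u ψ := by
  have h := Real.sin_sq_add_cos_sq ψ
  have ha : radialRate u ψ = (1 - u) * (-0.1 * Real.cos ψ ^ 2 + 1.5 * (Real.cos ψ * Real.sin ψ))
      + u * (-0.1 * Real.sin ψ ^ 2 - 1.5 * (Real.cos ψ * Real.sin ψ)) := by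
    unfold radialRate; ring
  have hp := sq_nonneg (Real.cos ψ + Real.sin ψ)
  have hm := sq_nonneg (Real.cos ψ - Real.sin ψ)
  have hC := sq_nonneg (Real.cos ψ)
  have hS := sq_nonneg (Real.sin ψ)
  rw [ha]
  set P := -0.1 * Real.cos ψ ^ 2 + 1.5 * (Real.cos ψ * Real.sin ψ) with hP
  set Q := -0.1 * Real.sin ψ ^ 2 - 1.5 * (Real.cos ψ * Real.sin ψ) with hQ
  have p1 : -0.85 ≤ P := by nlinarith
  have q1 : -0.85 ≤ Q := by nlinarith
  nlinarith

/-- The destabilizing feedback, switched to `0` past the angle `p`. -/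
noncomputable def switchCtrl (p ψ : ℝ) : ℝ := if ψ ≤ p then (1 - Real.sin (2 * ψ)) / 2 else 0

/-- The cutoff, equal to `1` up to the angle `p` and to `0` past `p + 1`. -/
noncomputable def cutoff (p ψ : ℝ) : ℝ := max 0 (min 1 (p + 1 - ψ))

lemma continuous_switchCtrl {p : ℝ} (hp : Real.sin (2 * p) = 1) : Continuous (switchCtrl p) := by
  refine Continuous.if_le (by fun_prop) continuous_const continuous_id continuous_const ?_
  rintro ψ rfl
  simp [hp]

lemma continuous_cutoff (p : ℝ) : Continuous (cutoff p) := by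
  unfold cutoff; fun_prop

lemma switchCtrl_mem (p ψ : ℝ) : 0 ≤ switchCtrl p ψ ∧ switchCtrl p ψ ≤ 1 := by
  unfold switchCtrl
  split_ifs
  · constructor <;> linarith [Real.sin_le_one (2 * ψ), Real.neg_one_le_sin (2 * ψ)]
  · norm_num

lemma cutoff_mem (p ψ : ℝ) : 0 ≤ cutoff p ψ ∧ cutoff p ψ ≤ 1 := by
  unfold cutoff
  exact ⟨le_max_left _ _, max_le zero_le_one (min_le_left _ _)⟩

lemma cutoff_eq_one {p ψ : ℝ} (h : ψ ≤ p) : cutoff p ψ = 1 := by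
  rw [cutoff, min_eq_left (by linarith), max_eq_right zero_le_one]

lemma cutoff_eq_zero {p ψ : ℝ} (h : p + 1 ≤ ψ) : cutoff p ψ = 0 := by
  rw [cutoff, max_eq_left ((min_le_right _ _).trans (by linarith))]

lemma switchCtrl_eq_zero {p ψ : ℝ} (hp : Real.sin (2 * p) = 1) (h : p ≤ ψ) :
    switchCtrl p ψ = 0 := by
  unfold switchCtrl
  split_ifs with h'
  · rw [le_antisymm h' h, hp]; norm_num
  · rfl

/-- Logarithm of the radius as a function of the angle. -/
noncomputable def logRadius (p ψ : ℝ) : ℝ :=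
  ∫ s in (0 : ℝ)..ψ, radialRate (switchCtrl p s) s / angularRate (switchCtrl p s) s

/-- The curve described by the state `x`, parametrized by the angle. -/
noncomputable def curve (p ψ : ℝ) : E2 := Real.exp (logRadius p ψ) • dir ψ

lemma norm_curve (p ψ : ℝ) : ‖curve p ψ‖ = Real.exp (logRadius p ψ) := by
  rw [curve, norm_smul, norm_dir, mul_one, Real.norm_eq_abs, Real.abs_exp]

lemma angularRate_pos (p ψ : ℝ) : 0 < angularRate (switchCtrl p ψ) ψ := by
  have := (angularRate_mem (switchCtrl_mem p ψ).1 (switchCtrl_mem p ψ).2 ψ).1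
  norm_num at this ⊢; linarith

lemma continuous_angularRate {p : ℝ} (hp : Real.sin (2 * p) = 1) :
    Continuous fun ψ => angularRate (switchCtrl p ψ) ψ := by
  have := continuous_switchCtrl hp
  unfold angularRate; fun_prop

lemma hasDerivAt_logRadius {p : ℝ} (hp : Real.sin (2 * p) = 1) (ψ : ℝ) :
    HasDerivAt (logRadius p)
      (radialRate (switchCtrl p ψ) ψ / angularRate (switchCtrl p ψ) ψ) ψ := by
  have hu := continuous_switchCtrl hp
  have hr : Continuous fun ψ => radialRate (switchCtrl p ψ) ψ := by
    unfold radialRate; fun_prop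
  exact ((hr.div (continuous_angularRate hp) fun s =>
    (angularRate_pos p s).ne').integral_hasStrictDerivAt 0 ψ).hasDerivAt

lemma continuous_logRadius {p : ℝ} (hp : Real.sin (2 * p) = 1) : Continuous (logRadius p) :=
  continuous_iff_continuousAt.mpr fun ψ => (hasDerivAt_logRadius hp ψ).continuousAt

lemma hasDerivAt_curve {p : ℝ} (hp : Real.sin (2 * p) = 1) (ψ : ℝ) :
    HasDerivAt (curve p) ((angularRate (switchCtrl p ψ) ψ)⁻¹ •
      act (switchCtrl p ψ • A1 + (1 - switchCtrl p ψ) • A0) (curve p ψ)) ψ := by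
  have h := (hasDerivAt_logRadius hp ψ).exp.smul (hasDerivAt_dir ψ)
  refine h.congr_deriv ?_
  have hτ := (angularRate_pos p ψ).ne'
  rw [curve, act_dir, smul_add, smul_smul, smul_smul, add_comm]
  congr 2 <;> field_simp

/-- Along the destabilizing feedback the radius grows exponentially in the angle. -/
lemma logRadius_growth {p ψ : ℝ} (hp : Real.sin (2 * p) = 1) (h0 : 0 ≤ ψ) (h1 : ψ ≤ p) :
    0.1 * ψ - 1 ≤ logRadius p ψ := by
  set f : ℝ → ℝ := fun s => 1.275 + 0.375 * Real.sin (4 * s) - 0.025 * Real.cos (4 * s) with hf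
  have hfm : ∀ s, 0.8 ≤ f s ∧ f s ≤ 1.7 := fun s => by
    simp only [hf]
    constructor <;> linarith [Real.sin_le_one (4 * s), Real.neg_one_le_sin (4 * s),
      Real.cos_le_one (4 * s), Real.neg_one_le_cos (4 * s)]
  have hfpos : ∀ s, 0 < f s := fun s => lt_of_lt_of_le (by norm_num) (hfm s).1
  have hdf : ∀ s, HasDerivAt f (1.5 * Real.cos (4 * s) + 0.1 * Real.sin (4 * s)) s := fun s => by
    have h4 : HasDerivAt (fun s : ℝ => 4 * s) 4 s := by
      simpa using (hasDerivAt_id s).const_mul (4 : ℝ)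
    refine (((h4.sin.const_mul 0.375).const_add 1.275).sub (h4.cos.const_mul 0.025)).congr_deriv ?_
    ring
  have h4 : ∀ s : ℝ, Real.sin (4 * s) = 4 * Real.sin s * Real.cos s * (2 * Real.cos s ^ 2 - 1) ∧
      Real.cos (4 * s) = 2 * (2 * Real.cos s ^ 2 - 1) ^ 2 - 1 := fun s => by
    rw [show 4 * s = 2 * (2 * s) by ring, Real.sin_two_mul, Real.cos_two_mul (2 * s),
      Real.sin_two_mul, Real.cos_two_mul]
    exact ⟨by ring, rfl⟩
  set F : ℝ → ℝ := fun s => logRadius p s + Real.log (f s) / 4 - 0.1 * s with hF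
  have hdF : ∀ s, HasDerivAt F (radialRate (switchCtrl p s) s / angularRate (switchCtrl p s) s +
      (1.5 * Real.cos (4 * s) + 0.1 * Real.sin (4 * s)) / f s / 4 - 0.1 * 1) s := fun s =>
    ((hasDerivAt_logRadius hp s).add (((hdf s).log (hfpos s).ne').div_const 4)).sub
      ((hasDerivAt_id s).const_mul _)
  have hmono : MonotoneOn F (Icc 0 p) := by
    refine monotoneOn_of_deriv_nonneg (convex_Icc 0 p)
      (fun s _ => (hdF s).continuousAt.continuousWithinAt)
      (fun s _ => (hdF s).differentiableAt.differentiableWithinAt) fun s hs => ?_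
    rw [interior_Icc] at hs
    rw [(hdF s).deriv]
    have hu : switchCtrl p s = (1 - 2 * Real.sin s * Real.cos s) / 2 := by
      rw [switchCtrl, if_pos hs.2.le, Real.sin_two_mul]
    have hsc : Real.sin s ^ 2 = 1 - Real.cos s ^ 2 := Real.sin_sq s
    have h3 : Real.sin s ^ 3 = Real.sin s * (1 - Real.cos s ^ 2) := by rw [← hsc]; ring
    have hτ : angularRate (switchCtrl p s) s = f s := by
      simp only [hf, (h4 s).1, (h4 s).2, hu, angularRate]
      ring_nf
      simp only [h3, hsc]
      ring
    have hρ : radialRate (switchCtrl p s) s =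
        0.325 - (1.5 * Real.cos (4 * s) + 0.1 * Real.sin (4 * s)) / 4 := by
      simp only [(h4 s).1, (h4 s).2, hu, radialRate]
      ring_nf
      simp only [h3, hsc]
      ring
    rw [hτ, hρ]
    have e : (0.325 - (1.5 * Real.cos (4 * s) + 0.1 * Real.sin (4 * s)) / 4) / f s +
        (1.5 * Real.cos (4 * s) + 0.1 * Real.sin (4 * s)) / f s / 4 - 0.1 * 1
        = 0.325 / f s - 0.1 := by ring
    rw [e, sub_nonneg, le_div_iff₀ (hfpos s)]
    linarith [(hfm s).2]
  have hle := hmono ⟨le_rfl, h0.trans h1⟩ ⟨h0, h1⟩ h0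
  have hf0 : 0 ≤ Real.log (f 0) := Real.log_nonneg (by norm_num [hf])
  have hfψ : Real.log (f ψ) ≤ 0.7 :=
    (Real.log_le_sub_one_of_pos (hfpos ψ)).trans (by linarith [(hfm ψ).2])
  have hL0 : logRadius p 0 = 0 := by simp [logRadius]
  simp only [hF, hL0] at hle
  linarith

lemma logRadius_decay {p a b : ℝ} (hp : Real.sin (2 * p) = 1) (hab : a ≤ b) :
    logRadius p a - 3 * (b - a) ≤ logRadius p b := by
  have hd : ∀ s, HasDerivAt (fun s => logRadius p s + 3 * s)
      (radialRate (switchCtrl p s) s / angularRate (switchCtrl p s) s + 3 * 1) s := fun s =>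
    (hasDerivAt_logRadius hp s).add ((hasDerivAt_id s).const_mul _)
  have hm : Monotone fun s => logRadius p s + 3 * s := by
    refine monotone_of_deriv_nonneg (fun s => (hd s).differentiableAt) fun s => ?_
    rw [(hd s).deriv]
    have hu := switchCtrl_mem p s
    have h1 := radialRate_ge hu.1 hu.2 s
    have h2 := (angularRate_mem hu.1 hu.2 s).1
    have : -3 ≤ radialRate (switchCtrl p s) s / angularRate (switchCtrl p s) s := by
      rw [le_div_iff₀ (angularRate_pos p s)]
      linarith
    linarith
  have := hm hab
  simp only at this
  linarith

/-- The speed `dψ/dt` at which the curve is run through. -/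
noncomputable def speed (p ψ : ℝ) : ℝ :=
  1000 * (1 + cutoff p ψ * Real.exp (logRadius p ψ) ^ 2) * angularRate (switchCtrl p ψ) ψ

lemma speed_pos (p ψ : ℝ) : 0 < speed p ψ := by
  have := (cutoff_mem p ψ).1
  have := angularRate_pos p ψ
  unfold speed; positivity

lemma continuous_speed {p : ℝ} (hp : Real.sin (2 * p) = 1) : Continuous (speed p) := by
  have := continuous_cutoff p
  have := continuous_logRadius hp
  have := continuous_angularRate hp
  unfold speed; fun_prop

lemma speed_le_of_ge {p ψ : ℝ} (h : p + 1 ≤ ψ) : speed p ψ ≤ 2100 := by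
  have := (angularRate_mem (switchCtrl_mem p ψ).1 (switchCtrl_mem p ψ).2 ψ).2
  rw [speed, cutoff_eq_zero h]
  linarith

lemma exists_speed_le {p : ℝ} (hp : Real.sin (2 * p) = 1) :
    ∃ B, 0 < B ∧ ∀ ψ, 0 ≤ ψ → speed p ψ ≤ B := by
  obtain ⟨C, hC⟩ := (isCompact_Icc (a := (0 : ℝ)) (b := p + 1)).exists_bound_of_continuousOn
    (continuous_speed hp).continuousOn
  refine ⟨max C 2100, by positivity, fun ψ h0 => ?_⟩
  rcases le_total ψ (p + 1) with h | h
  · exact ((le_abs_self _).trans (hC ψ ⟨h0, h⟩)).trans (le_max_left _ _)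
  · exact (speed_le_of_ge h).trans (le_max_right _ _)

lemma inv_speed_le (p ψ : ℝ) : (speed p ψ)⁻¹ ≤ 1 / 400 := by
  have h1 := (cutoff_mem p ψ).1
  have h2 := (angularRate_mem (switchCtrl_mem p ψ).1 (switchCtrl_mem p ψ).2 ψ).1
  rw [← one_div]
  refine one_div_le_one_div_of_le (by norm_num) ?_
  have : 0 ≤ cutoff p ψ * Real.exp (logRadius p ψ) ^ 2 := by positivity
  unfold speed
  nlinarith

lemma inv_speed_le_exp {p ψ : ℝ} (hp : Real.sin (2 * p) = 1) (h0 : 0 ≤ ψ) (h1 : ψ ≤ p) :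
    (speed p ψ)⁻¹ ≤ 1 / 400 * Real.exp (2 - 0.2 * ψ) := by
  have h2 := (angularRate_mem (switchCtrl_mem p ψ).1 (switchCtrl_mem p ψ).2 ψ).1
  have h3 : Real.exp (0.2 * ψ - 2) ≤ Real.exp (logRadius p ψ) ^ 2 := by
    rw [← Real.exp_nat_mul]
    refine Real.exp_le_exp.mpr ?_
    have := logRadius_growth hp h0 h1
    push_cast; linarith
  have h4 : 400 * Real.exp (0.2 * ψ - 2) ≤ speed p ψ := by
    rw [speed, cutoff_eq_one h1]
    have := Real.exp_pos (0.2 * ψ - 2)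
    nlinarith
  calc (speed p ψ)⁻¹ ≤ (400 * Real.exp (0.2 * ψ - 2))⁻¹ := by gcongr
    _ = 1 / 400 * Real.exp (2 - 0.2 * ψ) := by
      rw [mul_inv, ← Real.exp_neg, one_div, neg_sub]

/-- The time spent before the cutoff vanishes is at most `1`, independently of `p`. -/
lemma integral_inv_speed_le {p : ℝ} (hp : Real.sin (2 * p) = 1) (h0 : 0 ≤ p) :
    ∫ s in (0 : ℝ)..p + 1, (speed p (max s 0))⁻¹ ≤ 1 := by
  have hc : Continuous fun s => (speed p (max s 0))⁻¹ :=
    ((continuous_speed hp).comp (by fun_prop : Continuous fun s : ℝ => max s 0)).inv₀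
      fun s => (speed_pos p _).ne'
  have hI : ∀ a b, IntervalIntegrable (fun s => (speed p (max s 0))⁻¹) MeasureTheory.volume a b :=
    fun a b => hc.intervalIntegrable a b
  rw [← intervalIntegral.integral_add_adjacent_intervals (hI 0 p) (hI p (p + 1))]
  have hcE : Continuous fun s : ℝ => 1 / 400 * Real.exp (2 - 0.2 * s) := by fun_prop
  have e1 : ∫ s in (0 : ℝ)..p, (speed p (max s 0))⁻¹ ≤
      ∫ s in (0 : ℝ)..p, 1 / 400 * Real.exp (2 - 0.2 * s) := by
    refine intervalIntegral.integral_mono_on h0 (hI 0 p) (hcE.intervalIntegrable _ _)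
      fun s hs => ?_
    rw [max_eq_left hs.1]
    exact inv_speed_le_exp hp hs.1 hs.2
  have e2 : ∫ s in (0 : ℝ)..p, 1 / 400 * Real.exp (2 - 0.2 * s) =
      -(1 / 80) * Real.exp (2 - 0.2 * p) - -(1 / 80) * Real.exp (2 - 0.2 * 0) := by
    refine intervalIntegral.integral_eq_sub_of_hasDerivAt
      (f := fun s : ℝ => -(1 / 80) * Real.exp (2 - 0.2 * s)) (fun s _ => ?_)
      (hcE.intervalIntegrable _ _)
    refine ((((hasDerivAt_id s).const_mul (0.2 : ℝ)).const_sub 2).exp.const_mul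
      (-(1 / 80))).congr_deriv ?_
    simp only [id]
    ring
  have e3 : ∫ s in p..p + 1, (speed p (max s 0))⁻¹ ≤ ∫ _ in p..p + 1, (1 / 400 : ℝ) :=
    intervalIntegral.integral_mono_on (by linarith) (hI _ _) (by simp)
      fun s _ => inv_speed_le p _
  have e4 : ∫ _ in p..p + 1, (1 / 400 : ℝ) = 1 / 400 := by simp
  have e5 : Real.exp 2 ≤ 9 := by
    have := Real.exp_one_lt_d9
    rw [show (2 : ℝ) = 1 + 1 by norm_num, Real.exp_add]
    nlinarith [Real.exp_pos 1]
  have := Real.exp_pos (2 - 0.2 * p)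
  rw [mul_zero, sub_zero] at e2
  linarith

/-- The vector field of the system is `speed` times the velocity of `curve`. -/
lemma vectorField_eq {p : ℝ} (hp : Real.sin (2 * p) = 1) (ψ : ℝ) :
    (1000 * phi (cutoff p ψ)) • gfun (curve p ψ) (switchCtrl p ψ)
      + (1000 * (1 - phi (cutoff p ψ))) • act A0 (curve p ψ) =
    speed p ψ • (angularRate (switchCtrl p ψ) ψ)⁻¹ •
      act (switchCtrl p ψ • A1 + (1 - switchCtrl p ψ) • A0) (curve p ψ) := by
  rw [gfun, phi_eq_self (cutoff_mem p ψ).1 (cutoff_mem p ψ).2,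
    phi_eq_self (switchCtrl_mem p ψ).1 (switchCtrl_mem p ψ).2, norm_curve, speed, smul_smul,
    smul_smul, mul_inv_cancel_right₀ (angularRate_pos p ψ).ne']
  rcases le_total ψ p with h | h
  · rw [cutoff_eq_one h]; simp
  · rw [switchCtrl_eq_zero hp h]
    simp only [zero_smul, zero_add, sub_zero, one_smul, ← add_smul]
    congr 1; ring

/-- `(S_c)` is not weakly uniformly globally attractive: there are `c, ε, Δ > 0` such that
for every `T ≥ 0` some solution with `‖X0‖ ≤ Δ` satisfies `|X(t)| > ε` for all `t ∈ [0,T]`. -/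
theorem stmt_11 :
    ∃ c ε Δ : ℝ, 0 < c ∧ 0 < ε ∧ 0 < Δ ∧
      ∀ T : ℝ, 0 ≤ T →
        ∃ (x : ℝ → E2) (z1 z2 : ℝ → ℝ),
          IsSolution c x z1 z2 ∧ initNorm x z1 z2 ≤ Δ ∧
          ∀ t ∈ Icc (0 : ℝ) T, ε < Xnorm x z1 z2 t := by
  refine ⟨1000, 0.1, 2, by norm_num, by norm_num, by norm_num, fun T hT => ?_⟩
  obtain ⟨N, hN⟩ := exists_nat_ge (100000 * T + 100)
  set p : ℝ := Real.pi / 4 + N * Real.pi with hpdef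
  have hp : Real.sin (2 * p) = 1 := by
    rw [hpdef, show 2 * (Real.pi / 4 + N * Real.pi) = Real.pi / 2 + N * (2 * Real.pi) by ring,
      Real.sin_add_nat_mul_two_pi, Real.sin_pi_div_two]
  have hpT : 100000 * T + 100 ≤ p := by
    have := Real.pi_gt_three
    nlinarith [(Nat.cast_nonneg N : (0 : ℝ) ≤ N)]
  have hp0 : 0 ≤ p := by linarith
  obtain ⟨B, hB, hBle⟩ := exists_speed_le hp
  have hc : Continuous fun s => (speed p (max s 0))⁻¹ :=
    ((continuous_speed hp).comp (by fun_prop : Continuous fun s : ℝ => max s 0)).inv₀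
      fun s => (speed_pos p _).ne'
  obtain ⟨Ψ, hΨc, hΨm, hΨl, hΨr, hΨd⟩ := exists_clock hc (inv_pos.mpr hB) fun s =>
    inv_anti₀ (speed_pos p _) (hBle _ (le_max_right s 0))
  have hΨ0 : Ψ 0 = 0 := by simpa using hΨl 0
  have hΨ1 : ∀ t, 1 ≤ t → p + 1 ≤ Ψ t := fun t ht => by
    rw [← hΨl (p + 1)]
    exact hΨm.monotone ((integral_inv_speed_le hp hp0).trans ht)
  have hcurve : Continuous (curve p) :=
    continuous_iff_continuousAt.mpr fun ψ => (hasDerivAt_curve hp ψ).continuousAt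
  have hz : ∀ f : ℝ → ℝ, (∀ ψ, p + 1 ≤ ψ → f ψ = 0) → ∀ a : ℝ, 1 ≤ a → ∀ t : ℝ, 0 < t →
      HasDerivAt (fun t => f (Ψ (t + a))) (-(f (Ψ (t + a)))) t := by
    intro f hf a ha t ht
    rw [hf _ (hΨ1 _ (by linarith)), neg_zero]
    refine (hasDerivAt_const t (0 : ℝ)).congr_of_eventuallyEq ?_
    filter_upwards [lt_mem_nhds ht] with s hs
    exact hf _ (hΨ1 _ (by linarith))
  refine ⟨fun t => curve p (Ψ (max t 0)), fun t => switchCtrl p (Ψ (t + 1)),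
    fun t => cutoff p (Ψ (t + 2)), ⟨?_, ?_, ?_, fun t ht => ⟨?_, ?_, ?_⟩⟩, ?_, fun t ht => ?_⟩
  · exact (hcurve.comp (hΨc.comp (by fun_prop))).continuousOn
  · exact ((continuous_switchCtrl hp).comp (hΨc.comp (by fun_prop))).continuousOn
  · exact ((continuous_cutoff p).comp (hΨc.comp (by fun_prop))).continuousOn
  · simp only [sub_add_cancel, max_eq_left ht.le]
    rw [vectorField_eq hp]
    have hpos : 0 ≤ Ψ t := hΨ0 ▸ hΨm.monotone ht.le
    have hd := hΨd t
    rw [max_eq_left hpos, inv_inv] at hd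
    refine ((hasDerivAt_curve hp (Ψ t)).scomp t hd).congr_of_eventuallyEq ?_
    filter_upwards [lt_mem_nhds ht] with s hs
    simp [max_eq_left hs.le]
  · exact hz _ (fun ψ h => switchCtrl_eq_zero hp (by linarith)) 1 le_rfl t ht
  · exact hz _ (fun ψ h => cutoff_eq_zero h) 2 (by norm_num) t ht
  · refine csSup_le ⟨_, 0, by norm_num, rfl⟩ ?_
    rintro _ ⟨t, ht, rfl⟩
    rw [Xnorm, Real.sqrt_le_left (by norm_num), max_eq_right ht.2, hΨ0, norm_curve]
    have hL0 : logRadius p 0 = 0 := by simp [logRadius]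
    have h1 := switchCtrl_mem p (Ψ (t + 1))
    have h2 := cutoff_mem p (Ψ (t + 2))
    rw [hL0, Real.exp_zero]
    nlinarith
  · have hpos : 0 ≤ Ψ t := hΨ0 ▸ hΨm.monotone ht.1
    have hL : -1 ≤ logRadius p (Ψ t) := by
      rcases le_total (Ψ t) p with h | h
      · linarith [logRadius_growth hp hpos h]
      have hgrow := logRadius_growth hp hp0 le_rfl
      have hdec := logRadius_decay hp h
      have hΨt : Ψ t - (p + 1) ≤ 2100 * T := by
        rcases le_total (Ψ t) (p + 1) with h' | h'
        · linarith
        have hI : ∀ a b, IntervalIntegrable (fun s => (speed p (max s 0))⁻¹)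
            MeasureTheory.volume a b := fun a b => hc.intervalIntegrable a b
        have e1 := hΨr t
        rw [← intervalIntegral.integral_add_adjacent_intervals (hI 0 (p + 1)) (hI _ _)] at e1
        have e2 : 0 ≤ ∫ s in (0 : ℝ)..p + 1, (speed p (max s 0))⁻¹ :=
          intervalIntegral.integral_nonneg (by linarith) fun s _ =>
            (inv_pos.mpr (speed_pos p _)).le
        have e3 : ∫ _ in (p + 1)..Ψ t, (2100 : ℝ)⁻¹ ≤
            ∫ s in (p + 1)..Ψ t, (speed p (max s 0))⁻¹ := by
          refine intervalIntegral.integral_mono_on h' (by simp) (hI _ _) fun s hs => ?_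
          exact inv_anti₀ (speed_pos p _) (speed_le_of_ge (hs.1.trans (le_max_left _ _)))
        rw [intervalIntegral.integral_const, smul_eq_mul] at e3
        linarith [ht.2]
      linarith
    refine Real.lt_sqrt_of_sq_lt ?_
    simp only [max_eq_left ht.1, norm_curve]
    have h1 : 0.3 ≤ Real.exp (logRadius p (Ψ t)) := by
      refine le_trans ?_ (Real.exp_le_exp.mpr hL)
      rw [Real.exp_neg, le_inv_comm₀ (by norm_num) (Real.exp_pos 1)]
      have := Real.exp_one_lt_d9
      norm_num at this ⊢
      linarith
    nlinarith [sq_nonneg (switchCtrl p (Ψ (t + 1))), sq_nonneg (cutoff p (Ψ (t + 2)))]
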